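/- Let 0 < ε ≤ 1/8. There exists a continuous map ζ : ∂U₁ ∪ ∂U₂ → U(3) such that for each m ∈ {1, 2} and every u ∈ ∂U_m: ζ(A u)·ψ₀(1,0) = ψ_m(1,0)·ζ(u), ζ(B u)·ψ₀(0,1) = ψ_m(0,1)·ζ(u), and ζ(z u) = ζ(u) for every z ∈ ℂ with |z| = 1. Consequently the map α(u, s) = (u, ζ(u)·s) is a homeomorphism of (∂U₁ ∪ ∂U₂) × S⁵ onto itself over the identity of the base, which carries the action g·(u,s) = (φ(g)u, ψ₀(g)s) to the action that on ∂U_m × S⁵ is given by g·(u,s) = (φ(g)u, ψ_m(g)s); i.e. ∂E₀ is G̃₃-equivariantly isomorphic to ∂E₁ ∪ ∂E₂ as sphere bundles over ∂U₀ = ∂U₁ ∪ ∂U₂. -/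

import Mathlib

open Matrix

noncomputable section

/-- `ξ = exp(2πi/3)`, a primitive cube root of unity. -/
def ξ : ℂ := Complex.exp (2 * Real.pi * Complex.I / 3)

/-- The cyclic permutation matrix `A`, with rows `(0,1,0)`, `(0,0,1)`, `(1,0,0)`. -/
def A : Matrix (Fin 3) (Fin 3) ℂ := !![0, 1, 0; 0, 0, 1; 1, 0, 0]

/-- The diagonal matrix `B = diag(1, ξ, ξ²)`. -/
def B : Matrix (Fin 3) (Fin 3) ℂ := !![1, 0, 0; 0, ξ, 0; 0, 0, ξ ^ 2]

/-- The matrix `P = (1/√3)·[[1,ξ,1],[1,1,ξ],[ξ,1,1]]`. -/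
def P : Matrix (Fin 3) (Fin 3) ℂ :=
  (((Real.sqrt 3 : ℝ) : ℂ))⁻¹ • !![1, ξ, 1; 1, 1, ξ; ξ, 1, 1]

/-- `ψ₀(k,l) = ξ^k · diag(ξ^l, ξ^l, 1)`, the value of the representation `ψ₀` on `a^k b^l`. -/
def ψ0 (k l : ℤ) : Matrix (Fin 3) (Fin 3) ℂ := ξ ^ k • Matrix.diagonal ![ξ ^ l, ξ ^ l, 1]

/-- `ψ₁(k,l) = ξ^k · diag(ξ^l, ξ^{2l}, ξ^{2l})`. -/
def ψ1 (k l : ℤ) : Matrix (Fin 3) (Fin 3) ℂ := ξ ^ k • Matrix.diagonal ![ξ ^ l, ξ ^ (2 * l), ξ ^ (2 * l)]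

/-- `ψ₂(k,l) = ξ^k · diag(ξ^{2l}, 1, 1)`. -/
def ψ2 (k l : ℤ) : Matrix (Fin 3) (Fin 3) ℂ := ξ ^ k • Matrix.diagonal ![ξ ^ (2 * l), 1, 1]

/-- Euclidean space `ℂ³`. -/
abbrev E3 := EuclideanSpace ℂ (Fin 3)

/-- Application of a `3 × 3` complex matrix to a vector in `ℂ³`. -/
def app (M : Matrix (Fin 3) (Fin 3) ℂ) (v : E3) : E3 := Matrix.toEuclideanLin M v

/-- The unit sphere `S⁵ ⊆ ℂ³`. -/
abbrev S5 : Set E3 := Metric.sphere (0 : E3) 1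

/-- The subset `U₁ = {A^k v : k ∈ ℕ, ‖v‖ = 1, |v₂|² + |v₃|² ≤ ε}` of `S⁵`. -/
def U1 (ε : ℝ) : Set S5 :=
  {w | ∃ (k : ℕ) (v : E3), ‖v‖ = 1 ∧ ‖v 1‖ ^ 2 + ‖v 2‖ ^ 2 ≤ ε ∧ (w : E3) = app (A ^ k) v}

/-- The subset `U₂ = P · U₁` of `S⁵`. -/
def U2 (ε : ℝ) : Set S5 := {w | ∃ u ∈ U1 ε, (w : E3) = app P (u : E3)}

open ComplexConjugate

lemma ξ_pow_three : ξ ^ 3 = 1 := by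
  rw [ξ, ← Complex.exp_nat_mul, ← Complex.exp_two_pi_mul_I]
  congr 1
  push_cast
  ring

lemma isPrimitiveRoot_ξ : IsPrimitiveRoot ξ 3 := by
  simpa [ξ] using Complex.isPrimitiveRoot_exp 3 (by norm_num)

lemma one_add_ξ_add_ξ_sq : 1 + ξ + ξ ^ 2 = 0 := by
  simpa [Finset.sum_range_succ] using isPrimitiveRoot_ξ.geom_sum_eq_zero (by norm_num)

lemma norm_ξ : ‖ξ‖ = 1 := isPrimitiveRoot_ξ.norm'_eq_one (by norm_num)

lemma conj_ξ : conj ξ = ξ ^ 2 := by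
  rw [← Complex.inv_eq_conj norm_ξ]
  exact inv_eq_of_mul_eq_one_right (by rw [← ξ_pow_three]; ring)

lemma conj_mul_self_of_norm_eq_one {z : ℂ} (hz : ‖z‖ = 1) : conj z * z = 1 := by
  rw [Complex.conj_mul', hz]; simp

@[simp] lemma app_A_zero (v : E3) : app A v 0 = v 1 := by
  simp [app, A, Matrix.toLpLin_apply, dotProduct, Fin.sum_univ_three]

@[simp] lemma app_A_one (v : E3) : app A v 1 = v 2 := by
  simp [app, A, Matrix.toLpLin_apply, dotProduct, Fin.sum_univ_three]

@[simp] lemma app_A_two (v : E3) : app A v 2 = v 0 := by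
  simp [app, A, Matrix.toLpLin_apply, dotProduct, Fin.sum_univ_three]

@[simp] lemma app_B_zero (v : E3) : app B v 0 = v 0 := by
  simp [app, B, Matrix.toLpLin_apply, dotProduct, Fin.sum_univ_three]

@[simp] lemma app_B_one (v : E3) : app B v 1 = ξ * v 1 := by
  simp [app, B, Matrix.toLpLin_apply, dotProduct, Fin.sum_univ_three]

@[simp] lemma app_B_two (v : E3) : app B v 2 = ξ ^ 2 * v 2 := by
  simp [app, B, Matrix.toLpLin_apply, dotProduct, Fin.sum_univ_three]

lemma app_app (M N : Matrix (Fin 3) (Fin 3) ℂ) (v : E3) : app M (app N v) = app (M * N) v := by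
  simp [app]

lemma app_one (v : E3) : app 1 v = v := by
  simp [app]

lemma app_smul (M : Matrix (Fin 3) (Fin 3) ℂ) (z : ℂ) (v : E3) :
    app M (z • v) = z • app M v := map_smul _ _ _

lemma continuous_app (M : Matrix (Fin 3) (Fin 3) ℂ) : Continuous (app M) :=
  LinearMap.continuous_of_finiteDimensional _

lemma norm_app_of_conjTranspose_mul_self {M : Matrix (Fin 3) (Fin 3) ℂ} (hM : Mᴴ * M = 1)
    (v : E3) : ‖app M v‖ = ‖v‖ := by
  have h : inner ℂ (app M v) (app M v) = inner ℂ v v :=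
    calc inner ℂ (app M v) (app M v) = inner ℂ v (app Mᴴ (app M v)) := by
          rw [app, ← LinearMap.adjoint_inner_right, ← Matrix.toEuclideanLin_conjTranspose_eq_adjoint]
          rfl
      _ = inner ℂ v v := by rw [app_app, hM, app_one]
  rw [@norm_eq_sqrt_re_inner ℂ, h, ← @norm_eq_sqrt_re_inner ℂ]

lemma inv_sqrt_three_mul_self :
    (((Real.sqrt 3 : ℝ) : ℂ))⁻¹ * (((Real.sqrt 3 : ℝ) : ℂ))⁻¹ = 3⁻¹ := by
  rw [← mul_inv, ← Complex.ofReal_mul, Real.mul_self_sqrt (by norm_num)]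
  norm_num

lemma P_mul_conjTranspose : P * Pᴴ = 1 := by
  have h := inv_sqrt_three_mul_self
  have h3 := ξ_pow_three
  have h1 := one_add_ξ_add_ξ_sq
  ext i j
  fin_cases i <;> fin_cases j <;>
    simp [P, Matrix.mul_apply, Fin.sum_univ_three, conj_ξ] <;> grind

lemma conjTranspose_mul_P : Pᴴ * P = 1 := mul_eq_one_comm.mp P_mul_conjTranspose

lemma conjTranspose_P_mul_A : Pᴴ * A = A * Pᴴ := by
  have h : A * P = P * A := by
    ext i j
    fin_cases i <;> fin_cases j <;> simp [P, A, Matrix.mul_apply, Fin.sum_univ_three]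
  calc Pᴴ * A = Pᴴ * (A * P) * Pᴴ := by simp [mul_assoc, P_mul_conjTranspose]
    _ = A * Pᴴ := by rw [h, ← mul_assoc, conjTranspose_mul_P, one_mul]

lemma conjTranspose_P_mul_B : Pᴴ * B = A * B * Pᴴ := by
  have h3 := ξ_pow_three
  have h : B * P = P * (A * B) := by
    ext i j
    fin_cases i <;> fin_cases j <;> simp [P, A, B, Matrix.mul_apply, Fin.sum_univ_three] <;> grind
  calc Pᴴ * B = Pᴴ * (B * P) * Pᴴ := by simp [mul_assoc, P_mul_conjTranspose]
    _ = A * B * Pᴴ := by rw [h, ← mul_assoc, conjTranspose_mul_P, one_mul]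

lemma app_conjTranspose_P_app_A (v : E3) : app Pᴴ (app A v) = app A (app Pᴴ v) := by
  simp only [app_app, conjTranspose_P_mul_A]

lemma app_conjTranspose_P_app_B (v : E3) : app Pᴴ (app B v) = app A (app B (app Pᴴ v)) := by
  simp only [app_app, conjTranspose_P_mul_B, mul_assoc]

lemma norm_sq_eq_sum_three (v : E3) : ‖v‖ ^ 2 = ‖v 0‖ ^ 2 + ‖v 1‖ ^ 2 + ‖v 2‖ ^ 2 := by
  rw [EuclideanSpace.norm_sq_eq, Fin.sum_univ_three]

/-- The largest squared modulus of a coordinate. -/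
def maxSq (v : E3) : ℝ := max (max (‖v 0‖ ^ 2) (‖v 1‖ ^ 2)) (‖v 2‖ ^ 2)

lemma continuous_maxSq : Continuous maxSq := by
  unfold maxSq; fun_prop

lemma maxSq_app_A (v : E3) : maxSq (app A v) = maxSq v := by
  simp only [maxSq, app_A_zero, app_A_one, app_A_two]
  rw [max_comm, max_assoc]

lemma maxSq_app_B (v : E3) : maxSq (app B v) = maxSq v := by
  simp [maxSq, norm_ξ]

lemma maxSq_smul {z : ℂ} (hz : ‖z‖ = 1) (v : E3) : maxSq (z • v) = maxSq v := by
  simp [maxSq, hz]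

lemma maxSq_app_A_pow (k : ℕ) (v : E3) : maxSq (app (A ^ k) v) = maxSq v := by
  induction k with
  | zero => simp [app_one]
  | succ k ih => rw [pow_succ', ← app_app, maxSq_app_A, ih]

lemma A_pow_three : A ^ 3 = 1 := by
  ext i j
  fin_cases i <;> fin_cases j <;> simp [A, pow_succ, Matrix.mul_apply, Fin.sum_univ_three]

lemma conjTranspose_A_mul_A : Aᴴ * A = 1 := by
  ext i j
  fin_cases i <;> fin_cases j <;> simp [A, Matrix.mul_apply, Fin.sum_univ_three]

lemma mem_U1_iff (ε : ℝ) (u : S5) : u ∈ U1 ε ↔ 1 - ε ≤ maxSq u := by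
  have hu : ‖(u : E3)‖ = 1 := by simp
  constructor
  · rintro ⟨k, v, hv, hvε, h⟩
    rw [h, maxSq_app_A_pow]
    have := norm_sq_eq_sum_three v
    rw [hv] at this
    exact le_max_of_le_left (le_max_of_le_left (by linarith))
  · intro h
    have hs := norm_sq_eq_sum_three u
    rw [hu] at hs
    have hA (v : E3) : ‖app A v‖ = ‖v‖ := norm_app_of_conjTranspose_mul_self conjTranspose_A_mul_A v
    rw [maxSq, le_max_iff, le_max_iff] at h
    rcases h with (h | h) | h
    · exact ⟨0, u, hu, by linarith, by simp [app_one]⟩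
    · refine ⟨2, app A u, by rw [hA, hu], ?_, by rw [app_app, ← pow_succ, A_pow_three, app_one]⟩
      rw [app_A_one, app_A_two]; linarith
    · refine ⟨1, app A (app A u), by rw [hA, hA, hu], ?_, ?_⟩
      · rw [app_A_one, app_A_two, app_A_two, app_A_zero]; linarith
      · rw [app_app, app_app, pow_one, ← pow_two, ← pow_succ, A_pow_three, app_one]

lemma mem_U2_iff (ε : ℝ) (u : S5) : u ∈ U2 ε ↔ 1 - ε ≤ maxSq (app Pᴴ u) := by
  have hu : ‖(u : E3)‖ = 1 := by simp
  constructor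
  · rintro ⟨w, hw, h⟩
    rw [h, app_app, conjTranspose_mul_P, app_one]
    exact (mem_U1_iff ε w).mp hw
  · intro h
    have hn : ‖app Pᴴ u‖ = 1 := by
      rw [norm_app_of_conjTranspose_mul_self (by simp [P_mul_conjTranspose]), hu]
    refine ⟨⟨app Pᴴ u, by simpa using hn⟩, (mem_U1_iff ε _).mpr h, ?_⟩
    simp [app_app, P_mul_conjTranspose, app_one]

lemma frontier_U1_subset (ε : ℝ) : frontier (U1 ε) ⊆ {u : S5 | maxSq u = 1 - ε} := by
  have h : U1 ε = {u : S5 | 1 - ε ≤ maxSq u} := Set.ext (mem_U1_iff ε)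
  rw [h]
  exact (frontier_le_subset_eq continuous_const
    (continuous_maxSq.comp continuous_subtype_val)).trans fun u hu => Eq.symm hu

lemma frontier_U2_subset (ε : ℝ) : frontier (U2 ε) ⊆ {u : S5 | maxSq (app Pᴴ u) = 1 - ε} := by
  have h : U2 ε = {u : S5 | 1 - ε ≤ maxSq (app Pᴴ u)} := Set.ext (mem_U2_iff ε)
  rw [h]
  exact (frontier_le_subset_eq continuous_const (continuous_maxSq.comp
    ((continuous_app _).comp continuous_subtype_val))).trans fun u hu => Eq.symm hu

lemma sum_norm_sq_le_of_le_maxSq {v : E3} (hv : ‖v‖ = 1) (h : 7 / 8 ≤ maxSq v) :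
    (‖v 0‖ + ‖v 1‖ + ‖v 2‖) ^ 2 ≤ 9 / 4 := by
  have key : ∀ a b c : ℝ, 0 ≤ a → 0 ≤ b → 0 ≤ c → a ^ 2 + b ^ 2 + c ^ 2 = 1 → 7 / 8 ≤ a ^ 2 →
      (a + b + c) ^ 2 ≤ 9 / 4 := by
    intro a b c ha hb hc hs h
    have h1 : a ≤ 1 := by nlinarith
    have h2 : b + c ≤ 1 / 2 := abs_le_of_sq_le_sq' (by nlinarith [sq_nonneg (b - c)]) (by norm_num)
      |>.2
    nlinarith
  have hs := norm_sq_eq_sum_three v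
  rw [hv] at hs
  rw [maxSq, le_max_iff, le_max_iff] at h
  have h0 := norm_nonneg (v 0)
  have h1 := norm_nonneg (v 1)
  have h2 := norm_nonneg (v 2)
  rcases h with (h | h) | h
  · exact key _ _ _ h0 h1 h2 (by linarith) h
  · have := key _ _ _ h1 h0 h2 (by linarith) h
    linarith
  · have := key _ _ _ h2 h0 h1 (by linarith) h
    linarith

lemma norm_sq_app_conjTranspose_P_le (v : E3) (i : Fin 3) :
    ‖app Pᴴ v i‖ ^ 2 ≤ (‖v 0‖ + ‖v 1‖ + ‖v 2‖) ^ 2 / 3 := by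
  have hentry : ∀ j, ‖Pᴴ i j‖ = (Real.sqrt 3)⁻¹ := by
    intro j
    fin_cases i <;> fin_cases j <;> simp [P, norm_ξ]
  have happ : app Pᴴ v i = Pᴴ i 0 * v 0 + Pᴴ i 1 * v 1 + Pᴴ i 2 * v 2 := by
    simp only [app, Matrix.toLpLin_apply, Matrix.mulVec, dotProduct, Fin.sum_univ_three]
  have h : ‖app Pᴴ v i‖ ≤ (Real.sqrt 3)⁻¹ * (‖v 0‖ + ‖v 1‖ + ‖v 2‖) := by
    rw [happ]
    refine norm_add₃_le.trans_eq ?_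
    simp only [norm_mul, hentry]
    ring
  calc ‖app Pᴴ v i‖ ^ 2 ≤ ((Real.sqrt 3)⁻¹ * (‖v 0‖ + ‖v 1‖ + ‖v 2‖)) ^ 2 := by gcongr
    _ = (‖v 0‖ + ‖v 1‖ + ‖v 2‖) ^ 2 / 3 := by
      rw [mul_pow, inv_pow, Real.sq_sqrt (by norm_num)]; ring

lemma maxSq_app_conjTranspose_P_lt {v : E3} (hv : ‖v‖ = 1) (h : 7 / 8 ≤ maxSq v) :
    maxSq (app Pᴴ v) < 7 / 8 := by
  have h1 := sum_norm_sq_le_of_le_maxSq hv h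
  have h2 := norm_sq_app_conjTranspose_P_le v
  refine max_lt (max_lt ?_ ?_) ?_
  · linarith [h2 0]
  · linarith [h2 1]
  · linarith [h2 2]

/-- A cutoff that vanishes for `‖z‖² ≤ 1/2`. On the unit sphere of `ℂ³` it is nonzero on at most
one coordinate. -/
def cutoff (z : ℂ) : ℂ := ((max 0 (‖z‖ ^ 2 - 1 / 2) : ℝ) : ℂ)

lemma continuous_cutoff : Continuous cutoff := by
  unfold cutoff; fun_prop

lemma cutoff_mul {z : ℂ} (hz : ‖z‖ = 1) (w : ℂ) : cutoff (z * w) = cutoff w := by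
  simp [cutoff, hz]

lemma cutoff_eq_zero {z : ℂ} (hz : ‖z‖ ^ 2 ≤ 1 / 2) : cutoff z = 0 := by
  simp only [cutoff, Complex.ofReal_eq_zero]
  exact max_eq_left (by linarith)

lemma cutoff_ne_zero {z : ℂ} (hz : 1 / 2 < ‖z‖ ^ 2) : cutoff z ≠ 0 := by
  simp only [cutoff, ne_eq, Complex.ofReal_eq_zero]
  exact (lt_max_of_lt_right (by linarith)).ne'

/-- Where the coordinate `v j` dominates, a positive multiple of `v (j + 1) / v j`. -/
def coordX (v : E3) : ℂ :=
  cutoff (v 0) * (conj (v 0) * v 1) + cutoff (v 1) * (conj (v 1) * v 2) +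
    cutoff (v 2) * (conj (v 2) * v 0)

/-- Where the coordinate `v j` dominates, the same positive multiple of `v (j + 2) / v j`. -/
def coordY (v : E3) : ℂ :=
  cutoff (v 0) * (conj (v 0) * v 2) + cutoff (v 1) * (conj (v 1) * v 0) +
    cutoff (v 2) * (conj (v 2) * v 1)

lemma continuous_coordX : Continuous coordX := by
  have := continuous_cutoff
  unfold coordX; fun_prop

lemma continuous_coordY : Continuous coordY := by
  have := continuous_cutoff
  unfold coordY; fun_prop

lemma coordX_app_A (v : E3) : coordX (app A v) = coordX v := by
  simp only [coordX, app_A_zero, app_A_one, app_A_two]; ring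

lemma coordY_app_A (v : E3) : coordY (app A v) = coordY v := by
  simp only [coordY, app_A_zero, app_A_one, app_A_two]; ring

lemma norm_ξ_sq : ‖ξ ^ 2‖ = 1 := by simp [norm_ξ]

lemma coordX_app_B (v : E3) : coordX (app B v) = ξ * coordX v := by
  have h3 := ξ_pow_three
  simp only [coordX, app_B_zero, app_B_one, app_B_two, cutoff_mul norm_ξ, cutoff_mul norm_ξ_sq,
    map_mul, map_pow, conj_ξ]
  grind

lemma coordY_app_B (v : E3) : coordY (app B v) = ξ ^ 2 * coordY v := by
  have h3 := ξ_pow_three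
  simp only [coordY, app_B_zero, app_B_one, app_B_two, cutoff_mul norm_ξ, cutoff_mul norm_ξ_sq,
    map_mul, map_pow, conj_ξ]
  grind

lemma coordX_smul {z : ℂ} (hz : ‖z‖ = 1) (v : E3) : coordX (z • v) = coordX v := by
  have h := conj_mul_self_of_norm_eq_one hz
  simp only [coordX, PiLp.smul_apply, smul_eq_mul, cutoff_mul hz, map_mul]
  grind

lemma coordY_smul {z : ℂ} (hz : ‖z‖ = 1) (v : E3) : coordY (z • v) = coordY v := by
  have h := conj_mul_self_of_norm_eq_one hz
  simp only [coordY, PiLp.smul_apply, smul_eq_mul, cutoff_mul hz, map_mul]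
  grind

/-- The Euclidean norm of the pair `(coordX v, coordY v)`. -/
def coordNorm (v : E3) : ℝ := Real.sqrt (‖coordX v‖ ^ 2 + ‖coordY v‖ ^ 2)

lemma coordNorm_pos {v : E3} (hv : ‖v‖ = 1) (h : 1 / 2 < maxSq v) (h' : maxSq v < 1) :
    0 < coordNorm v := by
  suffices hne : ¬ (coordX v = 0 ∧ coordY v = 0) by
    refine Real.sqrt_pos.mpr ?_
    by_cases hx : coordX v = 0
    · have hy : coordY v ≠ 0 := fun hy => hne ⟨hx, hy⟩
      positivity
    · positivity
  have key : ∀ a b c : ℂ, ‖a‖ ^ 2 + ‖b‖ ^ 2 + ‖c‖ ^ 2 = 1 → 1 / 2 < ‖a‖ ^ 2 → ‖a‖ ^ 2 < 1 →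
      cutoff b = 0 ∧ cutoff c = 0 ∧ ¬ (cutoff a * (conj a * b) = 0 ∧ cutoff a * (conj a * c) = 0) := by
    intro a b c hs h1 h2
    refine ⟨cutoff_eq_zero (by nlinarith [sq_nonneg ‖c‖]),
      cutoff_eq_zero (by nlinarith [sq_nonneg ‖b‖]), ?_⟩
    have ha : a ≠ 0 := by rintro rfl; norm_num at h1
    simp only [mul_eq_zero, cutoff_ne_zero h1, map_eq_zero, ha, false_or]
    rintro ⟨rfl, rfl⟩
    simp only [norm_zero] at hs
    linarith
  have hs := norm_sq_eq_sum_three v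
  rw [hv] at hs
  have h0 := (le_max_left _ _).trans_lt ((le_max_left _ _).trans_lt h')
  have h1 := (le_max_right _ _).trans_lt ((le_max_left _ _).trans_lt h')
  have h2 := (le_max_right _ _).trans_lt h'
  rw [maxSq, lt_max_iff, lt_max_iff] at h
  unfold coordX coordY
  rcases h with (h | h) | h
  · obtain ⟨e1, e2, e⟩ := key _ (v 1) (v 2) (by linarith) h h0
    simpa [e1, e2] using e
  · obtain ⟨e1, e2, e⟩ := key _ (v 2) (v 0) (by linarith) h h1
    simpa [e1, e2] using e
  · obtain ⟨e1, e2, e⟩ := key _ (v 0) (v 1) (by linarith) h h2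
    simpa [e1, e2] using e

lemma continuous_coordNorm : Continuous coordNorm := by
  have := continuous_coordX
  have := continuous_coordY
  unfold coordNorm; fun_prop

lemma coordNorm_app_A (v : E3) : coordNorm (app A v) = coordNorm v := by
  simp [coordNorm, coordX_app_A, coordY_app_A]

lemma coordNorm_app_B (v : E3) : coordNorm (app B v) = coordNorm v := by
  simp [coordNorm, coordX_app_B, coordY_app_B, norm_ξ]

lemma coordNorm_smul {z : ℂ} (hz : ‖z‖ = 1) (v : E3) : coordNorm (z • v) = coordNorm v := by
  simp [coordNorm, coordX_smul hz, coordY_smul hz]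

/-- `coordX` normalized by `coordNorm`. -/
def unitX (v : E3) : ℂ := coordX v / coordNorm v

/-- `coordY` normalized by `coordNorm`. -/
def unitY (v : E3) : ℂ := coordY v / coordNorm v

lemma unitX_app_A (v : E3) : unitX (app A v) = unitX v := by
  simp [unitX, coordX_app_A, coordNorm_app_A]

lemma unitY_app_A (v : E3) : unitY (app A v) = unitY v := by
  simp [unitY, coordY_app_A, coordNorm_app_A]

lemma unitX_app_B (v : E3) : unitX (app B v) = ξ * unitX v := by
  simp [unitX, coordX_app_B, coordNorm_app_B, mul_div_assoc]

lemma unitY_app_B (v : E3) : unitY (app B v) = ξ ^ 2 * unitY v := by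
  simp [unitY, coordY_app_B, coordNorm_app_B, mul_div_assoc]

lemma unitX_smul {z : ℂ} (hz : ‖z‖ = 1) (v : E3) : unitX (z • v) = unitX v := by
  simp [unitX, coordX_smul hz, coordNorm_smul hz]

lemma unitY_smul {z : ℂ} (hz : ‖z‖ = 1) (v : E3) : unitY (z • v) = unitY v := by
  simp [unitY, coordY_smul hz, coordNorm_smul hz]

lemma unitX_mul_conj_add {v : E3} (h : 0 < coordNorm v) :
    unitX v * conj (unitX v) + unitY v * conj (unitY v) = 1 := by
  have hsq : coordNorm v ^ 2 = ‖coordX v‖ ^ 2 + ‖coordY v‖ ^ 2 := Real.sq_sqrt (by positivity)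
  rw [Complex.mul_conj', Complex.mul_conj', unitX, unitY, norm_div, norm_div, Complex.norm_real,
    Real.norm_of_nonneg h.le]
  norm_cast
  rw [div_pow, div_pow, ← add_div, ← hsq, div_self (by positivity)]

lemma continuousOn_unitX : ContinuousOn unitX {v | 0 < coordNorm v} :=
  continuous_coordX.continuousOn.div
    (Complex.continuous_ofReal.comp continuous_coordNorm).continuousOn
    fun _ hv => Complex.ofReal_ne_zero.mpr (ne_of_gt hv)

lemma continuousOn_unitY : ContinuousOn unitY {v | 0 < coordNorm v} :=
  continuous_coordY.continuousOn.div
    (Complex.continuous_ofReal.comp continuous_coordNorm).continuousOn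
    fun _ hv => Complex.ofReal_ne_zero.mpr (ne_of_gt hv)

/-- The transition matrix near the coordinate axes, intertwining `ψ0` and `ψ1`. -/
def transition1 (v : E3) : Matrix (Fin 3) (Fin 3) ℂ :=
  !![1, 0, 0; 0, unitX v, unitY v; 0, -conj (unitY v), conj (unitX v)]

/-- The transition matrix near the axes spanned by the columns of `P`, in the coordinates given
by `Pᴴ`, intertwining `ψ0` and `ψ2`. -/
def transition2 (v : E3) : Matrix (Fin 3) (Fin 3) ℂ :=
  !![unitX v, conj (unitY v), 0; 0, 0, 1; -unitY v, conj (unitX v), 0]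

lemma continuousOn_transition1 : ContinuousOn transition1 {v | 0 < coordNorm v} := by
  have hx := continuousOn_unitX
  have hy := continuousOn_unitY
  refine continuousOn_pi.mpr fun i => continuousOn_pi.mpr fun j => ?_
  fin_cases i <;> fin_cases j <;> simp [transition1] <;> fun_prop

lemma continuousOn_transition2 : ContinuousOn transition2 {v | 0 < coordNorm v} := by
  have hx := continuousOn_unitX
  have hy := continuousOn_unitY
  refine continuousOn_pi.mpr fun i => continuousOn_pi.mpr fun j => ?_
  fin_cases i <;> fin_cases j <;> simp [transition2] <;> fun_prop

lemma transition1_mem_unitaryGroup {v : E3} (h : 0 < coordNorm v) :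
    transition1 v ∈ Matrix.unitaryGroup (Fin 3) ℂ := by
  have := unitX_mul_conj_add h
  rw [Matrix.mem_unitaryGroup_iff, Matrix.star_eq_conjTranspose]
  ext i j
  fin_cases i <;> fin_cases j <;>
    simp [transition1, Matrix.mul_apply, Fin.sum_univ_three] <;> grind

lemma transition2_mem_unitaryGroup {v : E3} (h : 0 < coordNorm v) :
    transition2 v ∈ Matrix.unitaryGroup (Fin 3) ℂ := by
  have := unitX_mul_conj_add h
  rw [Matrix.mem_unitaryGroup_iff, Matrix.star_eq_conjTranspose]
  ext i j
  fin_cases i <;> fin_cases j <;>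
    simp [transition2, Matrix.mul_apply, Fin.sum_univ_three] <;> grind

lemma transition1_app_A (v : E3) : transition1 (app A v) = transition1 v := by
  simp only [transition1, unitX_app_A, unitY_app_A]

lemma transition2_app_A (v : E3) : transition2 (app A v) = transition2 v := by
  simp only [transition2, unitX_app_A, unitY_app_A]

lemma transition1_smul {z : ℂ} (hz : ‖z‖ = 1) (v : E3) :
    transition1 (z • v) = transition1 v := by
  simp only [transition1, unitX_smul hz, unitY_smul hz]

lemma transition2_smul {z : ℂ} (hz : ‖z‖ = 1) (v : E3) :
    transition2 (z • v) = transition2 v := by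
  simp only [transition2, unitX_smul hz, unitY_smul hz]

lemma ψ0_one_zero : ψ0 1 0 = ξ • 1 := by
  ext i j; fin_cases i <;> fin_cases j <;> simp [ψ0]

lemma ψ1_one_zero : ψ1 1 0 = ξ • 1 := by
  ext i j; fin_cases i <;> fin_cases j <;> simp [ψ1]

lemma ψ2_one_zero : ψ2 1 0 = ξ • 1 := by
  ext i j; fin_cases i <;> fin_cases j <;> simp [ψ2]

lemma ψ0_zero_one : ψ0 0 1 = Matrix.diagonal ![ξ, ξ, 1] := by simp [ψ0]

lemma ψ1_zero_one : ψ1 0 1 = Matrix.diagonal ![ξ, ξ ^ 2, ξ ^ 2] := by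
  simp only [ψ1, zpow_zero, one_smul, zpow_one, mul_one]; norm_cast

lemma ψ2_zero_one : ψ2 0 1 = Matrix.diagonal ![ξ ^ 2, 1, 1] := by
  simp only [ψ2, zpow_zero, one_smul, mul_one]; norm_cast

lemma transition1_app_B (v : E3) : transition1 (app B v) * ψ0 0 1 = ψ1 0 1 * transition1 v := by
  have h3 := ξ_pow_three
  rw [ψ0_zero_one, ψ1_zero_one]
  ext i j
  rw [Matrix.mul_diagonal, Matrix.diagonal_mul]
  fin_cases i <;> fin_cases j <;>
    simp [transition1, unitX_app_B, unitY_app_B, conj_ξ] <;> grind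

lemma transition2_app_B (v : E3) : transition2 (app B v) * ψ0 0 1 = ψ2 0 1 * transition2 v := by
  have h3 := ξ_pow_three
  rw [ψ0_zero_one, ψ2_zero_one]
  ext i j
  rw [Matrix.mul_diagonal, Matrix.diagonal_mul]
  fin_cases i <;> fin_cases j <;>
    simp [transition2, unitX_app_B, unitY_app_B, conj_ξ] <;> grind

/-- There is a continuous unitary-matrix-valued map `ζ` on `∂U₁ ∪ ∂U₂` intertwining the
representation `ψ₀` with `ψ_m` over `∂U_m` (`m = 1, 2`) and invariant under the central
circle; it induces the `G̃₃`-equivariant isomorphism `∂E₀ ≅ ∂E₁ ∪ ∂E₂` of sphere bundles. -/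
theorem exists_equivariant_transition_map (ε : ℝ) (hε0 : 0 < ε) (hε : ε ≤ 1 / 8) :
    ∃ ζ : S5 → Matrix (Fin 3) (Fin 3) ℂ,
      ContinuousOn ζ (frontier (U1 ε) ∪ frontier (U2 ε)) ∧
      (∀ u ∈ frontier (U1 ε) ∪ frontier (U2 ε), ζ u ∈ Matrix.unitaryGroup (Fin 3) ℂ) ∧
      (∀ u : S5, u ∈ frontier (U1 ε) →
        (∀ w : S5, (w : E3) = app A (u : E3) → ζ w * ψ0 1 0 = ψ1 1 0 * ζ u) ∧
        (∀ w : S5, (w : E3) = app B (u : E3) → ζ w * ψ0 0 1 = ψ1 0 1 * ζ u) ∧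
        (∀ z : ℂ, ‖z‖ = 1 → ∀ w : S5, (w : E3) = z • (u : E3) → ζ w = ζ u)) ∧
      (∀ u : S5, u ∈ frontier (U2 ε) →
        (∀ w : S5, (w : E3) = app A (u : E3) → ζ w * ψ0 1 0 = ψ2 1 0 * ζ u) ∧
        (∀ w : S5, (w : E3) = app B (u : E3) → ζ w * ψ0 0 1 = ψ2 0 1 * ζ u) ∧
        (∀ z : ℂ, ‖z‖ = 1 → ∀ w : S5, (w : E3) = z • (u : E3) → ζ w = ζ u)) := by
  set F1 : Set S5 := {u | maxSq u = 1 - ε} with hF1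
  set F2 : Set S5 := {u | maxSq (app Pᴴ u) = 1 - ε} with hF2
  have hsub1 : frontier (U1 ε) ⊆ F1 := frontier_U1_subset ε
  have hsub2 : frontier (U2 ε) ⊆ F2 := frontier_U2_subset ε
  have hnorm (u : S5) : ‖(u : E3)‖ = 1 := by simp
  have hcont : Continuous fun u : S5 => app Pᴴ (u : E3) :=
    (continuous_app _).comp continuous_subtype_val
  have hclosed1 : IsClosed F1 :=
    isClosed_eq (continuous_maxSq.comp continuous_subtype_val) continuous_const
  have hclosed2 : IsClosed F2 := isClosed_eq (continuous_maxSq.comp hcont) continuous_const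
  have hdisj : ∀ u ∈ F2, u ∉ F1 := by
    intro u h2 h1
    simp only [hF1, hF2, Set.mem_ofPred_eq] at h1 h2
    have := maxSq_app_conjTranspose_P_lt (hnorm u) (by linarith)
    linarith
  have hpos1 : ∀ u ∈ F1, 0 < coordNorm (u : E3) := by
    intro u h
    rw [hF1, Set.mem_ofPred_eq] at h
    exact coordNorm_pos (hnorm u) (by linarith) (by linarith)
  have hpos2 : ∀ u ∈ F2, 0 < coordNorm (app Pᴴ (u : E3)) := by
    intro u h
    rw [hF2, Set.mem_ofPred_eq] at h
    refine coordNorm_pos ?_ (by linarith) (by linarith)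
    rw [norm_app_of_conjTranspose_mul_self (by simp [P_mul_conjTranspose]), hnorm u]
  set ζ : S5 → Matrix (Fin 3) (Fin 3) ℂ :=
    fun u => if u ∈ F1 then transition1 u else transition2 (app Pᴴ u) with hζ
  have hζ1 : ∀ u ∈ F1, ζ u = transition1 u := fun u h => if_pos h
  have hζ2 : ∀ u ∈ F2, ζ u = transition2 (app Pᴴ u) := fun u h => if_neg (hdisj u h)
  have hζcont1 : ContinuousOn ζ F1 :=
    (continuousOn_transition1.comp continuous_subtype_val.continuousOn hpos1).congr hζ1
  have hζcont2 : ContinuousOn ζ F2 :=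
    (continuousOn_transition2.comp hcont.continuousOn hpos2).congr hζ2
  refine ⟨ζ, (hζcont1.union_of_isClosed hζcont2 hclosed1 hclosed2).mono
    (Set.union_subset_union hsub1 hsub2), ?_, ?_, ?_⟩
  · rintro u (hu | hu)
    · rw [hζ1 u (hsub1 hu)]
      exact transition1_mem_unitaryGroup (hpos1 u (hsub1 hu))
    · rw [hζ2 u (hsub2 hu)]
      exact transition2_mem_unitaryGroup (hpos2 u (hsub2 hu))
  · intro u hu
    have hu1 := hsub1 hu
    refine ⟨fun w hw => ?_, fun w hw => ?_, fun z hz w hw => ?_⟩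
    · have hw1 : w ∈ F1 := by
        rw [hF1, Set.mem_ofPred_eq, hw, maxSq_app_A]; exact hu1
      rw [hζ1 w hw1, hζ1 u hu1, hw, transition1_app_A, ψ0_one_zero, ψ1_one_zero]
      simp
    · have hw1 : w ∈ F1 := by
        rw [hF1, Set.mem_ofPred_eq, hw, maxSq_app_B]; exact hu1
      rw [hζ1 w hw1, hζ1 u hu1, hw, transition1_app_B]
    · have hw1 : w ∈ F1 := by
        rw [hF1, Set.mem_ofPred_eq, hw, maxSq_smul hz]; exact hu1
      rw [hζ1 w hw1, hζ1 u hu1, hw, transition1_smul hz]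
  · intro u hu
    have hu2 := hsub2 hu
    refine ⟨fun w hw => ?_, fun w hw => ?_, fun z hz w hw => ?_⟩
    · have hw2 : w ∈ F2 := by
        rw [hF2, Set.mem_ofPred_eq, hw, app_conjTranspose_P_app_A, maxSq_app_A]; exact hu2
      rw [hζ2 w hw2, hζ2 u hu2, hw, app_conjTranspose_P_app_A, transition2_app_A, ψ0_one_zero,
        ψ2_one_zero]
      simp
    · have hw2 : w ∈ F2 := by
        rw [hF2, Set.mem_ofPred_eq, hw, app_conjTranspose_P_app_B, maxSq_app_A, maxSq_app_B]
        exact hu2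
      rw [hζ2 w hw2, hζ2 u hu2, hw, app_conjTranspose_P_app_B, transition2_app_A,
        transition2_app_B]
    · have hw2 : w ∈ F2 := by
        rw [hF2, Set.mem_ofPred_eq, hw, app_smul, maxSq_smul hz]; exact hu2
      rw [hζ2 w hw2, hζ2 u hu2, hw, app_smul, transition2_smul hz]
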